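/- Let (X, hgt) be a quasiparabolic W-set with Bruhat order ≤, and let x, y ∈ X with x ≤ y and s ∈ S. Then: (1) either s·x ≤ y or s·x ≤ s·y; and (2) either x ≤ s·y or s·x ≤ s·y. In particular, if s·y ≤ y then s·x ≤ y, and if x ≤ s·x then x ≤ s·y. -/

import Mathlib

open CoxeterSystem

variable {B W : Type*} [Group W] {M : CoxeterMatrix B}

/-- A scaled `W`-set: heights change by at most 1 under simple reflections. -/
def IsScaled (cs : CoxeterSystem M W) {X : Type*} [MulAction W X] (hgt : X → ℤ) : Prop :=
  ∀ (b : B) (x : X), |hgt (cs.simple b • x) - hgt x| ≤ 1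

/-- A quasiparabolic `W`-set: scaled, plus (QP1) and (QP2). -/
def IsQuasiparabolic (cs : CoxeterSystem M W) {X : Type*} [MulAction W X] (hgt : X → ℤ) : Prop :=
  IsScaled cs hgt ∧
  (∀ (r : W) (x : X), cs.IsReflection r → hgt (r • x) = hgt x → r • x = x) ∧
  (∀ (r : W) (b : B) (x : X), cs.IsReflection r → hgt x < hgt (r • x) →
    hgt (cs.simple b • r • x) < hgt (cs.simple b • x) → r • x = cs.simple b • x)
/-- The Bruhat order on a quasiparabolic `W`-set: the reflexive–transitive closure
of the relation `x ≺ r • x` for reflections `r` with `hgt x < hgt (r • x)`. -/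
def BruhatLE (cs : CoxeterSystem M W) {X : Type*} [MulAction W X] (hgt : X → ℤ) :
    X → X → Prop :=
  Relation.ReflTransGen (fun x y => ∃ r : W, cs.IsReflection r ∧ y = r • x ∧ hgt x < hgt y)

/-- The strict Bruhat order. -/
def BruhatLT (cs : CoxeterSystem M W) {X : Type*} [MulAction W X] (hgt : X → ℤ)
    (x y : X) : Prop :=
  BruhatLE cs hgt x y ∧ x ≠ y

/-- A simple reflection either swaps the two ends of an elementary Bruhat relation or carries it
to another elementary Bruhat relation. -/
theorem IsQuasiparabolic.eq_simple_smul_or_simple_smul_lt (cs : CoxeterSystem M W) {X : Type*}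
    [MulAction W X] {hgt : X → ℤ} (hqp : IsQuasiparabolic cs hgt) (b : B) {x y : X}
    (h : ∃ r : W, cs.IsReflection r ∧ y = r • x ∧ hgt x < hgt y) :
    y = cs.simple b • x ∨
      ∃ r : W, cs.IsReflection r ∧ cs.simple b • y = r • cs.simple b • x ∧
        hgt (cs.simple b • x) < hgt (cs.simple b • y) := by
  obtain ⟨-, qp1, qp2⟩ := hqp
  obtain ⟨r, hr, rfl, hlt⟩ := h
  have hconj : cs.IsReflection (cs.simple b * r * (cs.simple b)⁻¹) := hr.conj _
  have hsmul : cs.simple b • r • x =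
      (cs.simple b * r * (cs.simple b)⁻¹) • cs.simple b • x := by
    simp only [mul_smul, inv_smul_smul]
  rcases lt_trichotomy (hgt (cs.simple b • x)) (hgt (cs.simple b • r • x)) with h | h | h
  · exact Or.inr ⟨_, hconj, hsmul, h⟩
  · have hfix := qp1 _ (cs.simple b • x) hconj (by rw [← hsmul, h])
    rw [← hsmul] at hfix
    rw [smul_left_cancel _ hfix] at hlt
    exact absurd hlt (lt_irrefl _)
  · exact Or.inl (qp2 r b x hr hlt h)

/-- lifting property of the Bruhat order on a quasiparabolic `W`-set. -/
theorem bruhat_lifting (cs : CoxeterSystem M W) {X : Type*} [MulAction W X]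
    (hgt : X → ℤ) (hqp : IsQuasiparabolic cs hgt) (x y : X) (b : B)
    (hxy : BruhatLE cs hgt x y) :
    (BruhatLE cs hgt (cs.simple b • x) y ∨
      BruhatLE cs hgt (cs.simple b • x) (cs.simple b • y)) ∧
    (BruhatLE cs hgt x (cs.simple b • y) ∨
      BruhatLE cs hgt (cs.simple b • x) (cs.simple b • y)) ∧
    (BruhatLE cs hgt (cs.simple b • y) y → BruhatLE cs hgt (cs.simple b • x) y) ∧
    (BruhatLE cs hgt x (cs.simple b • x) → BruhatLE cs hgt x (cs.simple b • y)) := by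
  have lower : BruhatLE cs hgt (cs.simple b • x) y ∨
      BruhatLE cs hgt (cs.simple b • x) (cs.simple b • y) := by
    induction hxy using Relation.ReflTransGen.head_induction_on with
    | refl => exact Or.inr .refl
    | head hxz hzy ih =>
      rcases hqp.eq_simple_smul_or_simple_smul_lt cs b hxz with rfl | hlt
      · exact Or.inl hzy
      · exact ih.imp (.head hlt) (.head hlt)
  have upper : BruhatLE cs hgt x (cs.simple b • y) ∨
      BruhatLE cs hgt (cs.simple b • x) (cs.simple b • y) := by
    clear lower
    induction hxy with
    | refl => exact Or.inr .refl
    | tail hxz hzy ih =>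
      rcases hqp.eq_simple_smul_or_simple_smul_lt cs b hzy with rfl | hlt
      · rw [← mul_smul, cs.simple_mul_simple_self, one_smul]
        exact Or.inl hxz
      · exact ih.imp (.tail · hlt) (.tail · hlt)
  exact ⟨lower, upper, fun hy => lower.elim id (.trans · hy), fun hx => upper.elim id hx.trans⟩
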